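/- arXiv:math/0311011 — 7 statements merged into one kernel-verified Lean document; each statement's English description precedes it below -/
import Mathlib

section
/- Let E be a real Banach space, let c ≥ 0, and let A : [0,1] → (E →L E) be a continuous family of continuous linear operators on E with ‖A(t)‖ ≤ c (operator norm) for all t ∈ [0,1]. Let v ∈ E and let f : [0,1] → E be twice continuously differentiable with f''(t) = A(t)(f(t)) for all t ∈ [0,1], f(0) = v, and f'(0) = −v. Then ‖f(1)‖ ≤ φ₋(√c)·‖v‖. -/
/-- `φ₋(x) = cosh x − (sinh x)/x` for `x > 0`, and `φ₋(0) = 0`. -/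
noncomputable def phiMinus (x : ℝ) : ℝ :=
  if x = 0 then 0 else Real.cosh x - Real.sinh x / x

/-- Comparison principle for second-order linear equations: a solution of `f'' = A(t) f` with
`‖A(t)‖ ≤ c` whose linearization at `0` is dominated by that of a scalar solution of
`G'' = c G` stays below `G`. -/
theorem norm_lt_of_second_order_comparison {E : Type*} [NormedAddCommGroup E] [NormedSpace ℝ E]
    {c : ℝ} {A : ℝ → E →L[ℝ] E} {f f' : ℝ → E} {G G' : ℝ → ℝ} {b : ℝ}
    (hA : ∀ t ∈ Set.Icc 0 b, ‖A t‖ ≤ c)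
    (hf : ∀ t ∈ Set.Icc 0 b, HasDerivAt f (f' t) t)
    (hf' : ∀ t ∈ Set.Icc 0 b, HasDerivAt f' (A t (f t)) t)
    (hG : ∀ t, HasDerivAt G (G' t) t) (hG' : ∀ t, HasDerivAt G' (c * G t) t)
    (hlt : ∀ t ∈ Set.Icc 0 b, ‖f 0 + t • f' 0‖ < G 0 + t * G' 0) :
    ∀ t ∈ Set.Icc 0 b, ‖f t‖ < G t := by
  by_contra! hne
  have hfc : ContinuousOn f (Set.Icc 0 b) := fun t ht => (hf t ht).continuousAt.continuousWithinAt
  have hGc : Continuous G := continuous_iff_continuousAt.2 fun t => (hG t).continuousAt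
  have hS : IsCompact {t ∈ Set.Icc 0 b | G t ≤ ‖f t‖} :=
    isCompact_Icc.of_isClosed_subset
      (isClosed_Icc.isClosed_le hGc.continuousOn hfc.norm) fun t ht => ht.1
  obtain ⟨s, ⟨hs, hGs⟩, hmin⟩ := hS.exists_isLeast hne
  have hsub : ∀ t ∈ Set.Icc 0 s, t ∈ Set.Icc 0 b := fun t ht => ⟨ht.1, ht.2.trans hs.2⟩
  have hbelow : ∀ t ∈ Set.Ico 0 s, ‖f t‖ ≤ G t := fun t ht => by
    by_contra! h
    exact absurd (hmin ⟨hsub t ⟨ht.1, ht.2.le⟩, h.le⟩) (not_le.2 ht.2)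
  have hderiv : ∀ t ∈ Set.Icc 0 s, ‖f' t - f' 0‖ ≤ G' t - G' 0 := by
    refine image_norm_le_of_norm_deriv_right_le_deriv_boundary
      (f' := fun t => A t (f t)) (B' := fun t => c * G t) ?_ ?_ (by simp) ?_ ?_
    · exact fun t ht => ((hf' t (hsub t ht)).sub_const _).continuousAt.continuousWithinAt
    · exact fun t ht => ((hf' t (hsub t ⟨ht.1, ht.2.le⟩)).sub_const _).hasDerivWithinAt
    · exact fun t => (hG' t).sub_const _
    · exact fun t ht => (A t).le_of_opNorm_le_of_le (hA t (hsub t ⟨ht.1, ht.2.le⟩)) (hbelow t ht)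
  have hlin : ∀ t, HasDerivAt (fun t : ℝ => f 0 + t • f' 0) (f' 0) t := fun t => by
    simpa using ((hasDerivAt_id t).smul_const (f' 0)).const_add (f 0)
  have hfun : ∀ t ∈ Set.Icc 0 s, ‖f t - (f 0 + t • f' 0)‖ ≤ G t - (G 0 + t * G' 0) := by
    refine image_norm_le_of_norm_deriv_right_le_deriv_boundary
      (f' := fun t => f' t - f' 0) (B' := fun t => G' t - G' 0) ?_ ?_ (by simp) ?_ ?_
    · exact fun t ht => ((hf t (hsub t ht)).sub (hlin t)).continuousAt.continuousWithinAt
    · exact fun t ht => ((hf t (hsub t ⟨ht.1, ht.2.le⟩)).sub (hlin t)).hasDerivWithinAt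
    · exact fun t => (hG t).fun_sub
        (by simpa using ((hasDerivAt_id t).mul_const (G' 0)).const_add (G 0))
    · exact fun t ht => hderiv t ⟨ht.1, ht.2.le⟩
  have h1 := hfun s ⟨hs.1, le_rfl⟩
  have h2 := hlt s hs
  have h3 := norm_le_norm_sub_add (f s) (f 0 + s • f' 0)
  linarith

/-- Analytic core of Proposition 2.5 of the paper: a solution of `f'' = A(t) f` on `[0,1]`
with `‖A(t)‖ ≤ c` and antidiagonal initial conditions `f(0) = v`, `f'(0) = −v` satisfies
`‖f(1)‖ ≤ φ₋(√c)·‖v‖`. -/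
theorem stmt1 {E : Type*} [NormedAddCommGroup E] [NormedSpace ℝ E] [CompleteSpace E]
    (c : ℝ) (hc : 0 ≤ c)
    (A : ℝ → E →L[ℝ] E)
    (hAcont : ContinuousOn A (Set.Icc 0 1))
    (hAbound : ∀ t ∈ Set.Icc (0:ℝ) 1, ‖A t‖ ≤ c)
    (v : E) (f f' f'' : ℝ → E)
    (hf' : ∀ t ∈ Set.Icc (0:ℝ) 1, HasDerivAt f (f' t) t)
    (hf'' : ∀ t ∈ Set.Icc (0:ℝ) 1, HasDerivAt f' (f'' t) t)
    (hf''cont : ContinuousOn f'' (Set.Icc 0 1))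
    (hode : ∀ t ∈ Set.Icc (0:ℝ) 1, f'' t = A t (f t))
    (h0 : f 0 = v) (h0' : f' 0 = -v) :
    ‖f 1‖ ≤ phiMinus (Real.sqrt c) * ‖v‖ := by
  have hlin : ∀ ε > 0, ∀ t ∈ Set.Icc (0:ℝ) 1, ‖f 0 + t • f' 0‖ < (‖v‖ + ε) + t * (-‖v‖) := by
    intro ε hε t ht
    have h : f 0 + t • f' 0 = (1 - t) • v := by rw [h0, h0']; module
    rw [h, norm_smul, Real.norm_of_nonneg (sub_nonneg.2 ht.2)]
    linarith
  have hfA : ∀ t ∈ Set.Icc (0:ℝ) 1, HasDerivAt f' (A t (f t)) t := fun t ht =>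
    hode t ht ▸ hf'' t ht
  have hone : (1:ℝ) ∈ Set.Icc (0:ℝ) 1 := by simp
  unfold phiMinus
  split_ifs with hk
  · have hc0 : c = 0 := (Real.sqrt_eq_zero hc).1 hk
    refine le_of_forall_pos_le_add fun ε hε => ?_
    have key := norm_lt_of_second_order_comparison (G := fun t => (‖v‖ + ε) + t * (-‖v‖))
      (G' := fun _ => -‖v‖) hAbound hf' hfA
      (fun t => by simpa using ((hasDerivAt_id t).mul_const (-‖v‖)).const_add (‖v‖ + ε))
      (fun t => by simpa [hc0] using hasDerivAt_const t (-‖v‖))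
      (by simpa using hlin ε hε) 1 hone
    linarith
  · set k := Real.sqrt c
    have hkk : k * k = c := Real.mul_self_sqrt hc
    refine le_of_forall_pos_le_add fun δ hδ => ?_
    have hcosh := Real.cosh_pos k
    have hmul : ∀ t : ℝ, HasDerivAt (fun t => k * t) k t := fun t => by
      simpa using (hasDerivAt_id t).const_mul k
    have key := norm_lt_of_second_order_comparison
      (G := fun t => (‖v‖ + δ / Real.cosh k) * Real.cosh (k * t) - ‖v‖ / k * Real.sinh (k * t))
      (G' := fun t => (‖v‖ + δ / Real.cosh k) * (Real.sinh (k * t) * k)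
        - ‖v‖ / k * (Real.cosh (k * t) * k)) hAbound hf' hfA
      (fun t => ((hmul t).cosh.const_mul _).sub ((hmul t).sinh.const_mul _))
      (fun t => by
        refine ((((hmul t).sinh.mul_const k).const_mul _).sub
          (((hmul t).cosh.mul_const k).const_mul _)).congr_deriv ?_
        rw [← hkk]; ring)
      (by simpa [hk] using hlin _ (div_pos hδ hcosh)) 1 hone
    refine key.le.trans (le_of_eq ?_)
    simp only [mul_one]
    field_simp
    ring
end

section
/- Let E be a real Banach space, let T be a continuous linear operator on E, and let v ∈ E. Define the operator power series c(B) = ∑_{n=0}^∞ Bⁿ/(2n)! and s(B) = ∑_{n=0}^∞ Bⁿ/(2n+1)! for a continuous linear operator B on E (these series converge absolutely in operator norm). Then the function f : ℝ → E defined by f(t) = c(t²·T)(v) − t·s(t²·T)(v) is twice differentiable and satisfies f''(t) = T(f(t)) for all t, f(0) = v, and f'(0) = −v; moreover, any twice-differentiable function g : ℝ → E with g'' = T∘g, g(0) = v, g'(0) = −v equals f. -/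
open scoped BigOperators

/-- The operator power series `c(B) = ∑ Bⁿ/(2n)!`. -/
noncomputable def opC {E : Type*} [NormedAddCommGroup E] [NormedSpace ℝ E]
    (B : E →L[ℝ] E) : E →L[ℝ] E :=
  ∑' n : ℕ, (((2 * n).factorial : ℝ))⁻¹ • B ^ n

/-- The operator power series `s(B) = ∑ Bⁿ/(2n+1)!`. -/
noncomputable def opS {E : Type*} [NormedAddCommGroup E] [NormedSpace ℝ E]
    (B : E →L[ℝ] E) : E →L[ℝ] E :=
  ∑' n : ℕ, (((2 * n + 1).factorial : ℝ))⁻¹ • B ^ n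

/-- The explicit solution `f(t) = c(t²T)v − t·s(t²T)v` of the Jacobi-type ODE
`f'' = T f` with antidiagonal initial conditions. -/
noncomputable def jacobiSol {E : Type*} [NormedAddCommGroup E] [NormedSpace ℝ E]
    (T : E →L[ℝ] E) (v : E) (t : ℝ) : E :=
  opC (t ^ 2 • T) v - t • opS (t ^ 2 • T) v

section JacobiSystem

variable {E : Type*} [NormedAddCommGroup E] [NormedSpace ℝ E]

/-- A power series with coefficients `(a n)!⁻¹`, where `n ≤ a n`, is summable in a Banach
algebra of operators. -/
theorem summable_inv_factorial_smul_pow [CompleteSpace E] (B : E →L[ℝ] E) {a : ℕ → ℕ}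
    (ha : ∀ n, n ≤ a n) : Summable fun n : ℕ => (((a n).factorial : ℝ))⁻¹ • B ^ n := by
  refine Summable.of_norm_bounded (NormedSpace.norm_expSeries_summable' (𝕂 := ℝ) B) fun n => ?_
  rw [norm_smul, norm_smul]
  gcongr ?_ * _
  rw [Real.norm_of_nonneg (by positivity), Real.norm_of_nonneg (by positivity)]
  have : n.factorial ≤ (a n).factorial := Nat.factorial_le (ha n)
  gcongr

theorem hasSum_opC [CompleteSpace E] (B : E →L[ℝ] E) (x : E) :
    HasSum (fun n : ℕ => (((2 * n).factorial : ℝ))⁻¹ • (B ^ n) x) (opC B x) :=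
  (summable_inv_factorial_smul_pow B (a := fun n => 2 * n) fun n => by lia).hasSum.mapL
    (ContinuousLinearMap.apply ℝ E x)

theorem hasSum_opS [CompleteSpace E] (B : E →L[ℝ] E) (x : E) :
    HasSum (fun n : ℕ => (((2 * n + 1).factorial : ℝ))⁻¹ • (B ^ n) x) (opS B x) :=
  (summable_inv_factorial_smul_pow B (a := fun n => 2 * n + 1) fun n => by lia).hasSum.mapL
    (ContinuousLinearMap.apply ℝ E x)

/-- The operator `(x, y) ↦ (y, T x)` of the first-order system equivalent to `f'' = T f`. -/
def companionOp (T : E →L[ℝ] E) : E × E →L[ℝ] E × E :=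
  (ContinuousLinearMap.snd ℝ E E).prod (T.comp (ContinuousLinearMap.fst ℝ E E))

@[simp]
theorem companionOp_apply (T : E →L[ℝ] E) (p : E × E) : companionOp T p = (p.2, T p.1) := rfl

theorem companionOp_pow_two_mul (T : E →L[ℝ] E) (n : ℕ) (p : E × E) :
    (companionOp T ^ (2 * n)) p = ((T ^ n) p.1, (T ^ n) p.2) := by
  induction n generalizing p with
  | zero => simp
  | succ n ih => simp [mul_add, pow_succ, ih]

theorem companionOp_pow_two_mul_add_one (T : E →L[ℝ] E) (n : ℕ) (p : E × E) :
    (companionOp T ^ (2 * n + 1)) p = ((T ^ n) p.2, (T ^ n) (T p.1)) := by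
  rw [pow_succ, mul_apply_eq_comp, companionOp_pow_two_mul, companionOp_apply]

theorem fst_exp_smul_companionOp [CompleteSpace E] (T : E →L[ℝ] E) (v : E) (t : ℝ) :
    (NormedSpace.exp (t • companionOp T) (v, -v)).1 = jacobiSol T v t := by
  have h := ((NormedSpace.exp_series_hasSum_exp' (𝕂 := ℝ) (t • companionOp T)).mapL
    (ContinuousLinearMap.apply ℝ (E × E) (v, -v))).mapL (ContinuousLinearMap.fst ℝ E E)
  refine h.unique ?_
  rw [jacobiSol, sub_eq_add_neg]
  refine HasSum.even_add_odd ?_ ?_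
  · convert hasSum_opC (t ^ 2 • T) v using 2 with n
    simp only [ContinuousLinearMap.apply_apply, smul_pow, smul_apply, companionOp_pow_two_mul,
      ContinuousLinearMap.coe_fst', Prod.smul_fst, pow_mul t]
  · convert ((hasSum_opS (t ^ 2 • T) v).const_smul t).neg using 2 with n
    simp only [ContinuousLinearMap.apply_apply, smul_pow, smul_apply,
      companionOp_pow_two_mul_add_one, ContinuousLinearMap.coe_fst', Prod.smul_fst, map_neg,
      smul_neg, smul_smul]
    congr 2
    ring

theorem hasDerivAt_exp_smul_companionOp [CompleteSpace E] (T : E →L[ℝ] E) (p : E × E) (t : ℝ) :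
    HasDerivAt (fun u : ℝ => NormedSpace.exp (u • companionOp T) p)
      (companionOp T (NormedSpace.exp (t • companionOp T) p)) t :=
  (ContinuousLinearMap.apply ℝ (E × E) p).hasFDerivAt.comp_hasDerivAt t
    (hasDerivAt_exp_smul_const' (companionOp T) t)

end JacobiSystem

/-- The function `f(t) = c(t²T)v − t·s(t²T)v` is twice differentiable, satisfies
`f'' = T ∘ f`, `f(0) = v`, `f'(0) = −v`, and is the unique such function. -/
theorem stmt2 {E : Type*} [NormedAddCommGroup E] [NormedSpace ℝ E] [CompleteSpace E]
    (T : E →L[ℝ] E) (v : E) :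
    ∃ f' : ℝ → E,
      (∀ t : ℝ, HasDerivAt (jacobiSol T v) (f' t) t) ∧
      (∀ t : ℝ, HasDerivAt f' (T (jacobiSol T v t)) t) ∧
      jacobiSol T v 0 = v ∧ f' 0 = -v ∧
      ∀ g g' : ℝ → E,
        (∀ t : ℝ, HasDerivAt g (g' t) t) →
        (∀ t : ℝ, HasDerivAt g' (T (g t)) t) →
        g 0 = v → g' 0 = -v → g = jacobiSol T v := by
  set F : ℝ → E × E := fun u => NormedSpace.exp (u • companionOp T) (v, -v) with hF
  have hFd (t : ℝ) : HasDerivAt F (companionOp T (F t)) t :=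
    hasDerivAt_exp_smul_companionOp T (v, -v) t
  have hF1 : jacobiSol T v = fun t => (F t).1 :=
    funext fun t => (fst_exp_smul_companionOp T v t).symm
  have hF0 : F 0 = (v, -v) := by simp [hF]
  rw [hF1]
  refine ⟨fun t => (F t).2, fun t => (hFd t).fst, fun t => (hFd t).snd, by simp [hF0],
    by simp [hF0], fun g g' hg hg' h0 h0' => ?_⟩
  have huniq : (fun t => (g t, g' t)) = F :=
    ODE_solution_unique_univ (v := fun _ => companionOp T) (s := fun _ => Set.univ) (t₀ := 0)
      (fun _ => (companionOp T).lipschitz.lipschitzOnWith)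
      (fun t => ⟨(hg t).prodMk (hg' t), Set.mem_univ _⟩)
      (fun t => ⟨hFd t, Set.mem_univ _⟩) (by simp [hF0, h0, h0'])
  exact funext fun t => congrArg Prod.fst (congrFun huniq t)
end

section
/- (i) The function r ↦ 1 − r·cot r (with value 0 at r = 0) is nonnegative, monotone increasing, and convex on the interval [0, π). (ii) The function r ↦ r·coth r − 1 (with value 0 at r = 0) is nonnegative, monotone increasing, and convex on [0, ∞). -/
open scoped Real

/-- `ψ(1,r) = 1 − r·cot r` for `r ∈ (0,π)`, extended by the value `0` at `r = 0`. -/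
noncomputable def psiPlusFun (r : ℝ) : ℝ :=
  if r = 0 then 0 else 1 - r * (Real.cos r / Real.sin r)

/-- `ψ(−1,r) = r·coth r − 1` for `r > 0`, extended by the value `0` at `r = 0`. -/
noncomputable def psiMinusFun (r : ℝ) : ℝ :=
  if r = 0 then 0 else r * (Real.cosh r / Real.sinh r) - 1

lemma mul_cos_le_sin {r : ℝ} (h₀ : 0 ≤ r) (hπ : r ≤ π) : r * Real.cos r ≤ Real.sin r := by
  have hd (x : ℝ) : HasDerivAt (fun y ↦ Real.sin y - y * Real.cos y) (x * Real.sin x) x := by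
    refine HasDerivAt.congr_deriv
      ((Real.hasDerivAt_sin x).sub ((hasDerivAt_id x).mul (Real.hasDerivAt_cos x))) ?_
    simp
  have hmono : MonotoneOn (fun y ↦ Real.sin y - y * Real.cos y) (Set.Icc 0 π) := by
    refine monotoneOn_of_hasDerivWithinAt_nonneg (convex_Icc 0 π)
      (fun x _ ↦ (hd x).continuousAt.continuousWithinAt)
      (fun x _ ↦ (hd x).hasDerivWithinAt) fun x hx ↦ ?_
    rw [interior_Icc] at hx
    exact mul_nonneg hx.1.le (Real.sin_pos_of_mem_Ioo hx).le
  simpa using hmono ⟨le_rfl, Real.pi_pos.le⟩ ⟨h₀, hπ⟩ h₀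

lemma sinh_le_mul_cosh {r : ℝ} (h₀ : 0 ≤ r) : Real.sinh r ≤ r * Real.cosh r := by
  have hd (x : ℝ) : HasDerivAt (fun y ↦ y * Real.cosh y - Real.sinh y) (x * Real.sinh x) x := by
    refine HasDerivAt.congr_deriv
      (((hasDerivAt_id x).mul (Real.hasDerivAt_cosh x)).sub (Real.hasDerivAt_sinh x)) ?_
    simp
  have hmono : MonotoneOn (fun y ↦ y * Real.cosh y - Real.sinh y) (Set.Ici 0) := by
    refine monotoneOn_of_hasDerivWithinAt_nonneg (convex_Ici 0)
      (fun x _ ↦ (hd x).continuousAt.continuousWithinAt)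
      (fun x _ ↦ (hd x).hasDerivWithinAt) fun x hx ↦ ?_
    rw [interior_Ici] at hx
    exact mul_nonneg (le_of_lt hx) (Real.sinh_pos_iff.2 hx).le
  simpa using hmono Set.self_mem_Ici h₀ h₀

lemma sin_mul_cos_le {r : ℝ} (h₀ : 0 ≤ r) : Real.sin r * Real.cos r ≤ r := by
  have h := Real.sin_le (x := 2 * r) (by positivity)
  rw [Real.sin_two_mul] at h
  linarith

lemma le_sinh_mul_cosh {r : ℝ} (h₀ : 0 ≤ r) : r ≤ Real.sinh r * Real.cosh r := by
  have h := Real.self_le_sinh_iff.2 (show 0 ≤ 2 * r by positivity)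
  rw [Real.sinh_two_mul] at h
  linarith

lemma psiPlusFun_eq_sinc : psiPlusFun = fun r ↦ 1 - Real.cos r / Real.sinc r := by
  ext r
  by_cases h : r = 0
  · simp [psiPlusFun, h]
  · rw [psiPlusFun, if_neg h, Real.sinc_of_ne_zero h, div_div_eq_mul_div]
    ring

lemma psiMinusFun_eq_dslope :
    psiMinusFun = fun r ↦ Real.cosh r / dslope Real.sinh 0 r - 1 := by
  ext r
  by_cases h : r = 0
  · simp [psiMinusFun, h]
  · rw [psiMinusFun, if_neg h, dslope_of_ne _ h, slope_def_field, Real.sinh_zero, sub_zero,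
      sub_zero, div_div_eq_mul_div]
    ring

lemma continuousOn_psiPlusFun : ContinuousOn psiPlusFun (Set.Ico 0 π) := by
  rw [psiPlusFun_eq_sinc]
  refine continuousOn_const.sub (Real.continuous_cos.continuousOn.div
    Real.continuous_sinc.continuousOn fun r hr ↦ ?_)
  rcases hr.1.eq_or_lt with rfl | h
  · simp
  · rw [Real.sinc_of_ne_zero h.ne']
    exact (div_pos (Real.sin_pos_of_pos_of_lt_pi h hr.2) h).ne'

lemma continuous_psiMinusFun : Continuous psiMinusFun := by
  rw [psiMinusFun_eq_dslope]
  have hc : Continuous (dslope Real.sinh 0) := by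
    refine continuous_iff_continuousAt.2 fun x ↦ ?_
    by_cases hx : x = 0
    · rw [hx, continuousAt_dslope_same]
      exact Real.differentiable_sinh 0
    · rw [continuousAt_dslope_of_ne hx]
      exact Real.continuous_sinh.continuousAt
  refine (Real.continuous_cosh.div hc fun r ↦ ?_).sub continuous_const
  by_cases h : r = 0
  · simp [h]
  · rw [dslope_of_ne _ h, slope_def_field, Real.sinh_zero, sub_zero, sub_zero]
    exact div_ne_zero (Real.sinh_ne_zero.2 h) h

lemma hasDerivAt_psiPlusFun {r : ℝ} (hr : r ≠ 0) (hs : Real.sin r ≠ 0) :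
    HasDerivAt psiPlusFun ((r - Real.sin r * Real.cos r) / Real.sin r ^ 2) r := by
  have h : HasDerivAt (fun x ↦ 1 - x * (Real.cos x / Real.sin x))
      ((r - Real.sin r * Real.cos r) / Real.sin r ^ 2) r := by
    refine HasDerivAt.congr_deriv
      (((hasDerivAt_id r).mul
      ((Real.hasDerivAt_cos r).div (Real.hasDerivAt_sin r) hs)).const_sub 1) ?_
    simp only [id, Pi.div_apply]
    field_simp
    linear_combination r * Real.sin_sq_add_cos_sq r
  refine h.congr_of_eventuallyEq ?_
  filter_upwards [eventually_ne_nhds hr] with x hx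
  simp [psiPlusFun, hx]

lemma hasDerivAt_psiMinusFun {r : ℝ} (hr : r ≠ 0) :
    HasDerivAt psiMinusFun ((Real.sinh r * Real.cosh r - r) / Real.sinh r ^ 2) r := by
  have hs : Real.sinh r ≠ 0 := Real.sinh_ne_zero.2 hr
  have h : HasDerivAt (fun x ↦ x * (Real.cosh x / Real.sinh x) - 1)
      ((Real.sinh r * Real.cosh r - r) / Real.sinh r ^ 2) r := by
    refine HasDerivAt.congr_deriv
      (((hasDerivAt_id r).mul
      ((Real.hasDerivAt_cosh r).div (Real.hasDerivAt_sinh r) hs)).sub_const 1) ?_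
    simp only [id, Pi.div_apply]
    field_simp
    linear_combination (-r) * Real.cosh_sq r
  refine h.congr_of_eventuallyEq ?_
  filter_upwards [eventually_ne_nhds hr] with x hx
  simp [psiMinusFun, hx]

lemma hasDerivAt_deriv_psiPlusFun {r : ℝ} (hs : Real.sin r ≠ 0) :
    HasDerivAt (fun x ↦ (x - Real.sin x * Real.cos x) / Real.sin x ^ 2)
      (2 * (Real.sin r - r * Real.cos r) / Real.sin r ^ 3) r := by
  refine HasDerivAt.congr_deriv
    (((hasDerivAt_id r).sub ((Real.hasDerivAt_sin r).mul (Real.hasDerivAt_cos r))).div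
    ((Real.hasDerivAt_sin r).pow 2) (pow_ne_zero 2 hs)) ?_
  simp only [id, Pi.sub_apply, Pi.mul_apply]
  field_simp
  push_cast
  linear_combination Real.sin r ^ 2 * Real.sin_sq_add_cos_sq r

lemma hasDerivAt_deriv_psiMinusFun {r : ℝ} (hs : Real.sinh r ≠ 0) :
    HasDerivAt (fun x ↦ (Real.sinh x * Real.cosh x - x) / Real.sinh x ^ 2)
      (2 * (r * Real.cosh r - Real.sinh r) / Real.sinh r ^ 3) r := by
  refine HasDerivAt.congr_deriv
    ((((Real.hasDerivAt_sinh r).mul (Real.hasDerivAt_cosh r)).sub (hasDerivAt_id r)).div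
    ((Real.hasDerivAt_sinh r).pow 2) (pow_ne_zero 2 hs)) ?_
  simp only [id, Pi.sub_apply, Pi.mul_apply]
  field_simp
  push_cast
  linear_combination (-Real.sinh r ^ 2) * Real.cosh_sq r

lemma monotoneOn_psiPlusFun : MonotoneOn psiPlusFun (Set.Ico 0 π) := by
  refine monotoneOn_of_hasDerivWithinAt_nonneg
    (f' := fun x ↦ (x - Real.sin x * Real.cos x) / Real.sin x ^ 2) (convex_Ico 0 π)
    continuousOn_psiPlusFun ?_ ?_ <;> intro x hx <;> rw [interior_Ico] at *
  · exact (hasDerivAt_psiPlusFun hx.1.ne' (Real.sin_pos_of_mem_Ioo hx).ne').hasDerivWithinAt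
  · exact div_nonneg (sub_nonneg.2 (sin_mul_cos_le hx.1.le)) (sq_nonneg _)

lemma monotoneOn_psiMinusFun : MonotoneOn psiMinusFun (Set.Ici 0) := by
  refine monotoneOn_of_hasDerivWithinAt_nonneg
    (f' := fun x ↦ (Real.sinh x * Real.cosh x - x) / Real.sinh x ^ 2) (convex_Ici 0)
    continuous_psiMinusFun.continuousOn ?_ ?_ <;> intro x hx <;> rw [interior_Ici] at *
  · exact (hasDerivAt_psiMinusFun (ne_of_gt hx)).hasDerivWithinAt
  · exact div_nonneg (sub_nonneg.2 (le_sinh_mul_cosh (le_of_lt hx))) (sq_nonneg _)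

lemma convexOn_psiPlusFun : ConvexOn ℝ (Set.Ico 0 π) psiPlusFun := by
  refine convexOn_of_hasDerivWithinAt2_nonneg
    (f' := fun x ↦ (x - Real.sin x * Real.cos x) / Real.sin x ^ 2)
    (f'' := fun x ↦ 2 * (Real.sin x - x * Real.cos x) / Real.sin x ^ 3) (convex_Ico 0 π)
    continuousOn_psiPlusFun ?_ ?_ ?_ <;> intro x hx <;> rw [interior_Ico] at * <;>
    have hs := Real.sin_pos_of_mem_Ioo hx
  · exact (hasDerivAt_psiPlusFun hx.1.ne' hs.ne').hasDerivWithinAt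
  · exact (hasDerivAt_deriv_psiPlusFun hs.ne').hasDerivWithinAt
  · have := sub_nonneg.2 (mul_cos_le_sin hx.1.le hx.2.le)
    positivity

lemma convexOn_psiMinusFun : ConvexOn ℝ (Set.Ici 0) psiMinusFun := by
  refine convexOn_of_hasDerivWithinAt2_nonneg
    (f' := fun x ↦ (Real.sinh x * Real.cosh x - x) / Real.sinh x ^ 2)
    (f'' := fun x ↦ 2 * (x * Real.cosh x - Real.sinh x) / Real.sinh x ^ 3) (convex_Ici 0)
    continuous_psiMinusFun.continuousOn ?_ ?_ ?_ <;> intro x hx <;> rw [interior_Ici] at * <;>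
    have hs := Real.sinh_pos_iff.2 hx
  · exact (hasDerivAt_psiMinusFun (ne_of_gt hx)).hasDerivWithinAt
  · exact (hasDerivAt_deriv_psiMinusFun hs.ne').hasDerivWithinAt
  · have := sub_nonneg.2 (sinh_le_mul_cosh (le_of_lt hx))
    positivity

/-- (i) `r ↦ 1 − r·cot r` is nonnegative, monotone increasing, and convex on `[0,π)`;
(ii) `r ↦ r·coth r − 1` is nonnegative, monotone increasing, and convex on `[0,∞)`. -/
theorem stmt6 :
    ((∀ r ∈ Set.Ico (0:ℝ) π, 0 ≤ psiPlusFun r) ∧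
      MonotoneOn psiPlusFun (Set.Ico (0:ℝ) π) ∧
      ConvexOn ℝ (Set.Ico (0:ℝ) π) psiPlusFun) ∧
    ((∀ r ∈ Set.Ici (0:ℝ), 0 ≤ psiMinusFun r) ∧
      MonotoneOn psiMinusFun (Set.Ici (0:ℝ)) ∧
      ConvexOn ℝ (Set.Ici (0:ℝ)) psiMinusFun) := by
  refine ⟨⟨fun r hr ↦ ?_, monotoneOn_psiPlusFun, convexOn_psiPlusFun⟩,
    fun r hr ↦ ?_, monotoneOn_psiMinusFun, convexOn_psiMinusFun⟩
  · simpa [psiPlusFun] using monotoneOn_psiPlusFun ⟨le_rfl, Real.pi_pos⟩ hr hr.1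
  · simpa [psiMinusFun] using monotoneOn_psiMinusFun Set.self_mem_Ici hr hr
end

section
/- Let E be a real Banach space, let U ⊆ E be an open convex set, let k₁, k₂ > 0 and ε ≥ 0, and let G : U → E be twice continuously differentiable such that for every x ∈ U: DG(x) is an invertible continuous linear operator with ‖DG(x)⁻¹‖ ≤ k₁⁻¹, ‖D²G(x)‖ ≤ k₂ (norm as a continuous bilinear map), and ‖G(x)‖ ≤ ε. Define Φ : U → E by Φ(x) = x − DG(x)⁻¹(G(x)), and set κ = k₂·k₁⁻²·ε. Then ‖DΦ(x)‖ ≤ κ for every x ∈ U; consequently, if κ < 1 then Φ is a contraction with constant κ on U, and if moreover p₀ ∈ E and ρ > 0 are such that the closed ball of radius ρ centered at p₀ is contained in U and ‖G(p₀)‖ < (1−κ)·k₁·ρ, then G has a unique zero p̄ in U, p̄ lies in the open ball B of radius ρ centered at p₀, and Φⁿ(q) → p̄ for every q ∈ B. -/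
open Filter Metric Topology

/-- The derivative of the Newton map `y ↦ y - A(y)⁻¹ (G y)`, where `A = DG`, in terms of the
second derivative `B = DA`. -/
theorem hasFDerivAt_newtonMap {E : Type*} [NormedAddCommGroup E] [NormedSpace ℝ E]
    [CompleteSpace E] {G : E → E} {A Ainv : E → E →L[ℝ] E} {B : E →L[ℝ] E →L[ℝ] E} {x : E}
    (hG : HasFDerivAt G (A x) x) (hA : HasFDerivAt A B x)
    (hleft : ∀ᶠ y in 𝓝 x, (Ainv y).comp (A y) = ContinuousLinearMap.id ℝ E)
    (hright : ∀ᶠ y in 𝓝 x, (A y).comp (Ainv y) = ContinuousLinearMap.id ℝ E) :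
    HasFDerivAt (fun y => y - Ainv y (G y))
      ((Ainv x).comp (B.flip (Ainv x (G x)))) x := by
  have hinverse : ∀ᶠ y in 𝓝 x, Ainv y = Ring.inverse (A y) := by
    filter_upwards [hleft, hright] with y hl hr
    exact (Ring.inverse_unit (⟨A y, Ainv y, hr, hl⟩ : (E →L[ℝ] E)ˣ)).symm
  have hl := hleft.self_of_nhds
  let u : (E →L[ℝ] E)ˣ := ⟨A x, Ainv x, hright.self_of_nhds, hl⟩
  have hAinv := ((hasFDerivAt_ringInverse (𝕜 := ℝ) u).comp x hA).congr_of_eventuallyEq hinverse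
  refine ((hasFDerivAt_id x).sub (hAinv.clm_apply hG)).congr_fderiv ?_
  ext h
  have hh : Ainv x (A x h) = h := DFunLike.congr_fun hl h
  simp [hh, u]

/-- A `K`-contraction of a closed ball which moves the center by less than `(1 - K) * r` has a
fixed point in the open ball, to which all iterations started in the closed ball converge. -/
theorem exists_fixedPoint_mem_ball_of_contracting {E : Type*} [MetricSpace E] [CompleteSpace E]
    {f : E → E} {c : E} {r K : ℝ} (hr : 0 ≤ r) (hK₀ : 0 ≤ K) (hK : K < 1)
    (hf : ∀ x ∈ closedBall c r, ∀ y ∈ closedBall c r, dist (f x) (f y) ≤ K * dist x y)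
    (hc : dist (f c) c < (1 - K) * r) :
    ∃ p ∈ ball c r, f p = p ∧
      ∀ q ∈ closedBall c r, Tendsto (fun n => f^[n] q) atTop (𝓝 p) := by
  have hcc : c ∈ closedBall c r := mem_closedBall_self hr
  have hmaps : Set.MapsTo f (closedBall c r) (closedBall c r) := by
    intro x hx
    have h₁ := dist_triangle (f x) (f c) c
    have h₂ := hf x hx c hcc
    have h₃ := mul_le_mul_of_nonneg_left (mem_closedBall.1 hx) hK₀
    rw [mem_closedBall]
    linarith
  have hcontr : ContractingWith ⟨K, hK₀⟩ (hmaps.restrict f _ _) :=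
    ⟨by exact_mod_cast hK, LipschitzWith.of_dist_le_mul fun x y => hf x x.2 y y.2⟩
  have hexists (q : E) (hq : q ∈ closedBall c r) :=
    hcontr.exists_fixedPoint' isClosed_closedBall.isComplete hmaps hq (edist_ne_top _ _)
  obtain ⟨p, hp, hfp, -⟩ := hexists c hcc
  refine ⟨p, ?_, hfp, fun q hq => ?_⟩
  · have h₁ := dist_triangle (f p) (f c) c
    have h₂ := hf p hp c hcc
    rw [hfp.eq] at h₁ h₂
    rw [mem_ball]
    nlinarith
  · obtain ⟨p', hp', hfp', hlim, -⟩ := hexists q hq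
    have h := hf p hp p' hp'
    rw [hfp.eq, hfp'.eq] at h
    have hdist : dist p p' = 0 := by nlinarith [dist_nonneg (x := p) (y := p')]
    rwa [dist_eq_zero.1 hdist]


/-- Euclidean (flat) instance of Case 2 of Theorem 2.7 of the paper (Newton's method).
If on an open convex `U` the `C²` map `G` satisfies `‖DG(x)⁻¹‖ ≤ k₁⁻¹`, `‖D²G(x)‖ ≤ k₂`,
`‖G(x)‖ ≤ ε`, then the Newton map `Φ(x) = x − DG(x)⁻¹(G(x))` has `‖DΦ(x)‖ ≤ κ` where
`κ = k₂k₁⁻²ε`; if `κ < 1` then `Φ` is a `κ`-contraction, and if in addition a closed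
ball `B̄(p₀,ρ) ⊆ U` satisfies `‖G(p₀)‖ < (1−κ)k₁ρ`, then `G` has a unique zero `p̄`
in `U`, `p̄` lies in the open ball, and all Newton iterations started in the open ball
converge to `p̄`. -/
theorem stmt9 {E : Type*} [NormedAddCommGroup E] [NormedSpace ℝ E] [CompleteSpace E]
    (U : Set E) (hUopen : IsOpen U) (hUconv : Convex ℝ U)
    (k₁ k₂ : ℝ) (hk₁ : 0 < k₁) (hk₂ : 0 < k₂) (ε : ℝ) (hε : 0 ≤ ε)
    (G : E → E) (G' : E → E →L[ℝ] E) (G'' : E → E →L[ℝ] E →L[ℝ] E)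
    (G'inv : E → E →L[ℝ] E)
    (hG' : ∀ x ∈ U, HasFDerivAt G (G' x) x)
    (hG'' : ∀ x ∈ U, HasFDerivAt G' (G'' x) x)
    (hG''cont : ContinuousOn G'' U)
    (hinv1 : ∀ x ∈ U, (G'inv x).comp (G' x) = ContinuousLinearMap.id ℝ E)
    (hinv2 : ∀ x ∈ U, (G' x).comp (G'inv x) = ContinuousLinearMap.id ℝ E)
    (hinvbd : ∀ x ∈ U, ‖G'inv x‖ ≤ k₁⁻¹)
    (hG''bd : ∀ x ∈ U, ‖G'' x‖ ≤ k₂)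
    (hGbd : ∀ x ∈ U, ‖G x‖ ≤ ε) :
    (∃ Φ' : E → E →L[ℝ] E, ∀ x ∈ U,
        HasFDerivAt (fun y => y - G'inv y (G y)) (Φ' x) x ∧
        ‖Φ' x‖ ≤ k₂ * k₁⁻¹ ^ 2 * ε) ∧
    (k₂ * k₁⁻¹ ^ 2 * ε < 1 →
      (∀ x ∈ U, ∀ y ∈ U,
        ‖(x - G'inv x (G x)) - (y - G'inv y (G y))‖ ≤ k₂ * k₁⁻¹ ^ 2 * ε * ‖x - y‖) ∧
      (∀ p₀ : E, ∀ ρ : ℝ, 0 < ρ → Metric.closedBall p₀ ρ ⊆ U →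
        ‖G p₀‖ < (1 - k₂ * k₁⁻¹ ^ 2 * ε) * k₁ * ρ →
        ∃ p : E, p ∈ Metric.ball p₀ ρ ∧ G p = 0 ∧
          (∀ q ∈ U, G q = 0 → q = p) ∧
          ∀ q ∈ Metric.ball p₀ ρ,
            Filter.Tendsto (fun n => (fun y => y - G'inv y (G y))^[n] q)
              Filter.atTop (nhds p))) := by
  set κ := k₂ * k₁⁻¹ ^ 2 * ε with hκ
  have hκ₀ : 0 ≤ κ := by positivity
  have hderiv : ∀ x ∈ U, HasFDerivAt (fun y => y - G'inv y (G y))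
      ((G'inv x).comp ((G'' x).flip (G'inv x (G x)))) x := fun x hx =>
    have hU := hUopen.mem_nhds hx
    hasFDerivAt_newtonMap (hG' x hx) (hG'' x hx)
      (eventually_of_mem hU hinv1) (eventually_of_mem hU hinv2)
  have hbound : ∀ x ∈ U, ‖(G'inv x).comp ((G'' x).flip (G'inv x (G x)))‖ ≤ κ := by
    intro x hx
    calc ‖(G'inv x).comp ((G'' x).flip (G'inv x (G x)))‖
        ≤ ‖G'inv x‖ * ‖(G'' x).flip (G'inv x (G x))‖ := ContinuousLinearMap.opNorm_comp_le _ _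
      _ ≤ ‖G'inv x‖ * (‖G'' x‖ * (‖G'inv x‖ * ‖G x‖)) := by
          gcongr
          refine ((G'' x).flip.le_opNorm _).trans ?_
          rw [ContinuousLinearMap.opNorm_flip]
          gcongr
          exact (G'inv x).le_opNorm _
      _ ≤ k₁⁻¹ * (k₂ * (k₁⁻¹ * ε)) := by
          gcongr
          exacts [hinvbd x hx, hG''bd x hx, hinvbd x hx, hGbd x hx]
      _ = κ := by rw [hκ]; ring
  refine ⟨⟨_, fun x hx => ⟨hderiv x hx, hbound x hx⟩⟩, fun hκ₁ => ?_⟩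
  have hlip : ∀ x ∈ U, ∀ y ∈ U,
      ‖(x - G'inv x (G x)) - (y - G'inv y (G y))‖ ≤ κ * ‖x - y‖ := fun x hx y hy =>
    hUconv.norm_image_sub_le_of_norm_hasFDerivWithin_le
      (fun z hz => (hderiv z hz).hasFDerivWithinAt) hbound hy hx
  refine ⟨hlip, fun p₀ ρ hρ hball hGp₀ => ?_⟩
  have hp₀ : p₀ ∈ U := hball (mem_closedBall_self hρ.le)
  have hmove : dist (p₀ - G'inv p₀ (G p₀)) p₀ < (1 - κ) * ρ := by
    rw [dist_eq_norm, sub_sub_cancel_left, norm_neg]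
    calc ‖G'inv p₀ (G p₀)‖ ≤ k₁⁻¹ * ‖G p₀‖ := (G'inv p₀).le_of_opNorm_le (hinvbd p₀ hp₀) _
      _ < k₁⁻¹ * ((1 - κ) * k₁ * ρ) := by gcongr
      _ = (1 - κ) * ρ := by field_simp
  obtain ⟨p, hp, hfix, hlim⟩ := exists_fixedPoint_mem_ball_of_contracting
    (f := fun y => y - G'inv y (G y)) hρ.le hκ₀ hκ₁
    (fun x hx y hy => by simpa only [dist_eq_norm] using hlip x (hball hx) y (hball hy)) hmove
  have hpU : p ∈ U := hball (ball_subset_closedBall hp)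
  refine ⟨p, hp, ?_, fun q hq hGq => ?_, fun q hq => hlim q (ball_subset_closedBall hq)⟩
  · have h := DFunLike.congr_fun (hinv2 p hpU) (G p)
    simpa [sub_eq_self.1 hfix] using h.symm
  · have h := hlip q hq p hpU
    rw [show p - G'inv p (G p) = p from hfix, hGq, map_zero, sub_zero] at h
    have hnorm : ‖q - p‖ = 0 := by nlinarith [norm_nonneg (q - p)]
    exact sub_eq_zero.1 (norm_eq_zero.1 hnorm)
end

section
/- Let E be a finite-dimensional real inner product space (e.g. Euclidean space ℝⁿ), let U ⊆ E be an open set whose closure is compact, and let f be a real-valued continuously differentiable function defined on an open neighborhood of the closure of U. Suppose that at every boundary point p of U the gradient ∇f(p) is outward-pointing for U at p. Then the minimum of f over the closure of U is not attained at any boundary point of U; it is attained at some point q ∈ U with ∇f(q) = 0. -/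
/-- A vector `v` is outward-pointing for the set `U` at the point `p` if `v ≠ 0` and
there is a `C¹` curve `γ` defined around `0` with `γ(0) = p`, `γ'(0) = −v`, and
`γ(t) ∈ U` for all small `t > 0`. -/
def OutwardPointing {E : Type*} [NormedAddCommGroup E] [NormedSpace ℝ E]
    (U : Set E) (p : E) (v : E) : Prop :=
  v ≠ 0 ∧ ∃ ε : ℝ, 0 < ε ∧ ∃ γ γ' : ℝ → E,
    γ 0 = p ∧ γ' 0 = -v ∧
    (∀ t ∈ Set.Ioo (-ε) ε, HasDerivAt γ (γ' t) t) ∧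
    ContinuousOn γ' (Set.Ioo (-ε) ε) ∧
    ∀ t ∈ Set.Ioo (0:ℝ) ε, γ t ∈ U

/-- If the gradient of `f` at `p` is outward-pointing for `U`, then `U` contains a point at
which `f` is smaller than at `p`. -/
theorem OutwardPointing.exists_lt {E : Type*} [NormedAddCommGroup E] [InnerProductSpace ℝ E]
    [CompleteSpace E] {U : Set E} {p v : E} {f : E → ℝ}
    (h : OutwardPointing U p v) (hf : HasGradientAt f v p) : ∃ x ∈ U, f x < f p := by
  obtain ⟨hv, ε, hε, γ, γ', h0, h0', hγ, -, hU⟩ := h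
  have hd : HasDerivAt γ (-v) 0 := h0' ▸ hγ 0 ⟨by linarith, hε⟩
  have hg : HasDerivAt (f ∘ γ) (-‖v‖ ^ 2) 0 := by
    subst h0
    have := hf.hasFDerivAt.comp_hasDerivAt (0 : ℝ) hd
    simpa using this
  have hneg : -‖v‖ ^ 2 < 0 := neg_lt_zero.mpr (pow_pos (norm_pos_iff.mpr hv) 2)
  obtain ⟨t, ht, htε⟩ := ((hg.tendsto_slope_zero_right.eventually_lt_const hneg).and
    (Ioo_mem_nhdsGT hε)).exists
  refine ⟨γ t, hU t htε, ?_⟩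
  simp only [zero_add, Function.comp_apply, h0, smul_eq_mul] at ht
  exact sub_neg.mp ((pos_iff_neg_of_mul_neg ht).mp (inv_pos.mpr htε.1))

/-- Euclidean instance of part (a) of Lemma 3.12 of the paper: if `U` is open with
compact closure and the gradient of the `C¹` function `f` is outward-pointing at each
boundary point of `U`, then the minimum of `f` over the closure of `U` is not attained
on the boundary, and is attained at a critical point `q ∈ U`. -/
theorem stmt13 {E : Type*} [NormedAddCommGroup E] [InnerProductSpace ℝ E]
    [FiniteDimensional ℝ E]
    (U : Set E) (hUopen : IsOpen U) (hUne : U.Nonempty)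
    (hUcpt : IsCompact (closure U))
    (V : Set E) (hVopen : IsOpen V) (hUV : closure U ⊆ V)
    (f : E → ℝ) (f' : E → E)
    (hf : ∀ x ∈ V, HasGradientAt f (f' x) x)
    (hf'cont : ContinuousOn f' V)
    (hout : ∀ p ∈ frontier U, OutwardPointing U p (f' p)) :
    (∀ p ∈ frontier U, ¬ (∀ x ∈ closure U, f p ≤ f x)) ∧
    ∃ q ∈ U, f' q = 0 ∧ ∀ x ∈ closure U, f q ≤ f x := by
  have hbdry : ∀ p ∈ frontier U, ¬ (∀ x ∈ closure U, f p ≤ f x) := by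
    intro p hp hmin
    obtain ⟨x, hx, hlt⟩ := (hout p hp).exists_lt (hf p (hUV (frontier_subset_closure hp)))
    exact (hmin x (subset_closure hx)).not_gt hlt
  refine ⟨hbdry, ?_⟩
  obtain ⟨q, hq, hmin⟩ := hUcpt.exists_isMinOn hUne.closure
    fun x hx => (hf x (hUV hx)).continuousAt.continuousWithinAt
  have hqU : q ∈ U := by
    by_contra hqU
    exact hbdry q (hUopen.frontier_eq ▸ ⟨hq, hqU⟩) hmin
  have hloc : IsLocalMin f q :=
    hmin.isLocalMin (Filter.mem_of_superset (hUopen.mem_nhds hqU) subset_closure)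
  exact ⟨q, hqU, by simpa using hloc.hasFDerivAt_eq_zero (hf q (hUV hq)).hasFDerivAt, hmin⟩
end

section
/- Fix real numbers δ ≤ Δ and r₁ > 0 with 2·r₁·√(max(0,Δ)) < π, and define κ̃ and s̃ as in the context. Then for each D ∈ [0, r₁], the function ρ ↦ s̃(ρ, D) is concave on the interval [D, r₁] and attains its maximum over [D, r₁] at a unique point. -/
open scoped Real

/-- `C₁(λ,r) = 1` if `λ ≥ 0` or `r = 0`, and `sinh(√(−λ)·r)/(√(−λ)·r)` if `λ < 0, r ≠ 0`. -/
noncomputable def C1 (lam r : ℝ) : ℝ :=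
  if 0 ≤ lam ∨ r = 0 then 1
  else Real.sinh (Real.sqrt (-lam) * r) / (Real.sqrt (-lam) * r)

/-- `h(λ,r)`: equal to `√λ·r·cot(√λ·r)` for `λ > 0`, to `√(−λ)·r·coth(√(−λ)·r)` for
`λ < 0`, and to `1` when `λ = 0` or `r = 0`. -/
noncomputable def hFun (lam r : ℝ) : ℝ :=
  if lam = 0 ∨ r = 0 then 1
  else if 0 < lam then
    Real.sqrt lam * r * (Real.cos (Real.sqrt lam * r) / Real.sin (Real.sqrt lam * r))
  else
    Real.sqrt (-lam) * r * (Real.cosh (Real.sqrt (-lam) * r) / Real.sinh (Real.sqrt (-lam) * r))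

/-- `ψ(λ,r) = sign(λ)·(1 − h(λ,r))`. -/
noncomputable def psiFun (lam r : ℝ) : ℝ := Real.sign lam * (1 - hFun lam r)

/-- `ψmax(δ,Δ,r) = max(ψ(Δ,r), ψ(δ,r))`. -/
noncomputable def psiMax (δ Δ r : ℝ) : ℝ := max (psiFun Δ r) (psiFun δ r)

/-- The contraction-constant function `κ̃(ρ,D)` of Definition 4.4 with constant
curvature bounds `δ ≤ Δ`: `κ̃(ρ,D) = φ₋((ρ+D)√K) + C₁(δ,ρ+D)·ψmax(δ,Δ,ρ+D)` where
`K = max(|δ|,|Δ|)`. -/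
noncomputable def kappaT (δ Δ ρ D : ℝ) : ℝ :=
  phiMinus ((ρ + D) * Real.sqrt (max |δ| |Δ|)) + C1 δ (ρ + D) * psiMax δ Δ (ρ + D)

/-- The margin function `s̃(ρ,D) = (1 − κ̃(ρ,D))·ρ` of Definition 4.4. -/
noncomputable def sT (δ Δ ρ D : ℝ) : ℝ := (1 - kappaT δ Δ ρ D) * ρ

/-- `f` is continuous, convex, nondecreasing and nonnegative on `[0, b]`. -/
structure ConvexMonoNonneg (b : ℝ) (f : ℝ → ℝ) : Prop where
  continuousOn : ContinuousOn f (Set.Icc 0 b)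
  convexOn : ConvexOn ℝ (Set.Icc 0 b) f
  monotoneOn : MonotoneOn f (Set.Icc 0 b)
  nonneg : ∀ ⦃x⦄, x ∈ Set.Icc 0 b → 0 ≤ f x

namespace ConvexMonoNonneg

variable {b : ℝ} {f g : ℝ → ℝ}

theorem congr (hf : ConvexMonoNonneg b f) (hfg : Set.EqOn f g (Set.Icc 0 b)) :
    ConvexMonoNonneg b g where
  continuousOn := hf.continuousOn.congr hfg.symm
  convexOn := hf.convexOn.congr hfg
  monotoneOn := hf.monotoneOn.congr hfg
  nonneg _ hx := hfg hx ▸ hf.nonneg hx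

theorem const {c : ℝ} (hc : 0 ≤ c) : ConvexMonoNonneg b fun _ => c where
  continuousOn := continuousOn_const
  convexOn := convexOn_const c (convex_Icc 0 b)
  monotoneOn := monotoneOn_const
  nonneg _ _ := hc

theorem add (hf : ConvexMonoNonneg b f) (hg : ConvexMonoNonneg b g) :
    ConvexMonoNonneg b (f + g) where
  continuousOn := hf.continuousOn.add hg.continuousOn
  convexOn := hf.convexOn.add hg.convexOn
  monotoneOn := hf.monotoneOn.add hg.monotoneOn
  nonneg _ hx := add_nonneg (hf.nonneg hx) (hg.nonneg hx)

theorem mul (hf : ConvexMonoNonneg b f) (hg : ConvexMonoNonneg b g) :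
    ConvexMonoNonneg b (f * g) where
  continuousOn := hf.continuousOn.mul hg.continuousOn
  convexOn := hf.convexOn.mul hg.convexOn hf.nonneg hg.nonneg
    (hf.monotoneOn.monovaryOn hg.monotoneOn)
  monotoneOn _ hx _ hy hxy :=
    mul_le_mul (hf.monotoneOn hx hy hxy) (hg.monotoneOn hx hy hxy) (hg.nonneg hx) (hf.nonneg hy)
  nonneg _ hx := mul_nonneg (hf.nonneg hx) (hg.nonneg hx)

theorem sup (hf : ConvexMonoNonneg b f) (hg : ConvexMonoNonneg b g) :
    ConvexMonoNonneg b (f ⊔ g) where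
  continuousOn := hf.continuousOn.sup hg.continuousOn
  convexOn := hf.convexOn.sup hg.convexOn
  monotoneOn := hf.monotoneOn.sup hg.monotoneOn
  nonneg _ hx := (hf.nonneg hx).trans le_sup_left

theorem comp_mul_left {c : ℝ} (hc : 0 ≤ c) (hf : ConvexMonoNonneg (c * b) f) :
    ConvexMonoNonneg b fun x => f (c * x) := by
  have hmaps : ∀ x ∈ Set.Icc 0 b, c * x ∈ Set.Icc 0 (c * b) := fun x hx =>
    ⟨mul_nonneg hc hx.1, mul_le_mul_of_nonneg_left hx.2 hc⟩
  refine ⟨hf.continuousOn.comp (by fun_prop) hmaps, ⟨convex_Icc 0 b, ?_⟩, ?_,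
    fun x hx => hf.nonneg (hmaps x hx)⟩
  · intro x hx y hy s t hs ht hst
    have h := hf.convexOn.2 (hmaps x hx) (hmaps y hy) hs ht hst
    have e : c * (s • x + t • y) = s • (c * x) + t • (c * y) := by
      simp only [smul_eq_mul]; ring
    simpa only [e] using h
  · intro x hx y hy hxy
    exact hf.monotoneOn (hmaps x hx) (hmaps y hy) (mul_le_mul_of_nonneg_left hxy hc)

/-- A convex function on `[0, b]` attaining its minimum at `0` is nondecreasing. -/
theorem of_convexOn (hc : ContinuousOn f (Set.Icc 0 b)) (hconv : ConvexOn ℝ (Set.Icc 0 b) f)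
    (h0 : 0 ≤ f 0) (hmin : ∀ x ∈ Set.Icc 0 b, f 0 ≤ f x) : ConvexMonoNonneg b f := by
  refine ⟨hc, hconv, ?_, fun x hx => h0.trans (hmin x hx)⟩
  intro x hx y hy hxy
  rcases hx.1.eq_or_lt with rfl | hx0
  · exact hmin y hy
  have hy0 : 0 < y := hx0.trans_le hxy
  have h0mem : (0 : ℝ) ∈ Set.Icc 0 b := ⟨le_rfl, hy.1.trans hy.2⟩
  have hle : x / y ≤ 1 := (div_le_one hy0).2 hxy
  have h := hconv.2 h0mem hy (sub_nonneg.2 hle) (by positivity : 0 ≤ x / y) (by ring)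
  have e : (1 - x / y) • (0 : ℝ) + (x / y) • y = x := by
    simp only [smul_eq_mul]; field_simp; ring
  rw [e] at h
  simp only [smul_eq_mul] at h
  nlinarith [mul_le_mul_of_nonneg_left (hmin y hy) (sub_nonneg.2 hle)]

theorem of_hasDerivAt {f' f'' : ℝ → ℝ} (hc : ContinuousOn f (Set.Icc 0 b))
    (hfg : Set.EqOn f g (Set.Ioo 0 b))
    (hg : ∀ x ∈ Set.Ioo 0 b, HasDerivAt g (f' x) x)
    (hf' : ∀ x ∈ Set.Ioo 0 b, HasDerivAt f' (f'' x) x)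
    (hf'' : ∀ x ∈ Set.Ioo 0 b, 0 ≤ f'' x)
    (h0 : 0 ≤ f 0) (hmin : ∀ x ∈ Set.Icc 0 b, f 0 ≤ f x) : ConvexMonoNonneg b f := by
  refine of_convexOn hc ?_ h0 hmin
  refine convexOn_of_hasDerivWithinAt2_nonneg (f' := f') (f'' := f'') (convex_Icc 0 b) hc ?_ ?_ ?_
    <;> rw [interior_Icc] <;> intro x hx
  · exact (hg x hx).hasDerivWithinAt.congr hfg (hfg hx)
  · exact (hf' x hx).hasDerivWithinAt
  · exact hf'' x hx

theorem strictMonoOn (hf : ConvexMonoNonneg b f) (h0 : f 0 = 0)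
    (hpos : ∀ x ∈ Set.Ioc 0 b, 0 < f x) : StrictMonoOn f (Set.Icc 0 b) := by
  intro x hx y hy hxy
  have hy0 : 0 < y := hx.1.trans_lt hxy
  have h0mem : (0 : ℝ) ∈ Set.Icc 0 b := ⟨le_rfl, hy.1.trans hy.2⟩
  have hlt : x / y < 1 := (div_lt_one hy0).2 hxy
  have h := hf.convexOn.2 h0mem hy (sub_nonneg.2 hlt.le) (div_nonneg hx.1 hy0.le) (by ring)
  have e : (1 - x / y) • (0 : ℝ) + (x / y) • y = x := by
    simp only [smul_eq_mul]; field_simp; ring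
  rw [e, h0] at h
  simp only [smul_eq_mul] at h
  nlinarith [mul_lt_mul_of_pos_right hlt (hpos y ⟨hy0, hy.2⟩)]

end ConvexMonoNonneg

theorem Real.sinh_lt_mul_cosh {x : ℝ} (hx : 0 < x) : Real.sinh x < x * Real.cosh x := by
  have hd : ∀ y : ℝ, HasDerivAt (fun y => y * Real.cosh y - Real.sinh y) (y * Real.sinh y) y := by
    intro y
    refine HasDerivAt.congr_deriv (((hasDerivAt_id' y).mul (Real.hasDerivAt_cosh y)).sub (Real.hasDerivAt_sinh y)) ?_
    ring
  have hm : StrictMonoOn (fun y => y * Real.cosh y - Real.sinh y) (Set.Ici 0) := by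
    refine strictMonoOn_of_deriv_pos (convex_Ici 0) (by fun_prop) fun y hy => ?_
    rw [interior_Ici, Set.mem_Ioi] at hy
    rw [(hd y).deriv]
    exact mul_pos hy (Real.sinh_pos_iff.2 hy)
  have h := hm Set.self_mem_Ici hx.le hx
  simp only [zero_mul, Real.sinh_zero, sub_zero] at h
  linarith

theorem Real.mul_cos_lt_sin {x : ℝ} (hx : 0 < x) (hxπ : x ≤ π) : x * Real.cos x < Real.sin x := by
  have hd : ∀ y : ℝ, HasDerivAt (fun y => Real.sin y - y * Real.cos y) (y * Real.sin y) y := by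
    intro y
    refine HasDerivAt.congr_deriv ((Real.hasDerivAt_sin y).sub ((hasDerivAt_id' y).mul (Real.hasDerivAt_cos y))) ?_
    ring
  have hm : StrictMonoOn (fun y => Real.sin y - y * Real.cos y) (Set.Icc 0 π) := by
    refine strictMonoOn_of_deriv_pos (convex_Icc 0 π) (by fun_prop) fun y hy => ?_
    rw [interior_Icc] at hy
    rw [(hd y).deriv]
    exact mul_pos hy.1 (Real.sin_pos_of_mem_Ioo hy)
  have h := hm ⟨le_rfl, Real.pi_pos.le⟩ ⟨hx.le, hxπ⟩ hx
  simp only [zero_mul, Real.sin_zero, sub_zero] at h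
  linarith

theorem Real.two_mul_mul_cosh_le {x : ℝ} (hx : 0 ≤ x) :
    2 * x * Real.cosh x ≤ x ^ 2 * Real.sinh x + 2 * Real.sinh x := by
  have hd : ∀ y : ℝ, HasDerivAt
      (fun y => y ^ 2 * Real.sinh y + 2 * Real.sinh y - 2 * y * Real.cosh y)
      (y ^ 2 * Real.cosh y) y := by
    intro y
    refine HasDerivAt.congr_deriv ((((hasDerivAt_pow 2 y).mul (Real.hasDerivAt_sinh y)).add
      ((Real.hasDerivAt_sinh y).const_mul 2)).sub
      (((hasDerivAt_id' y).const_mul 2).mul (Real.hasDerivAt_cosh y))) ?_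
    simp; ring
  have hm : Monotone (fun y => y ^ 2 * Real.sinh y + 2 * Real.sinh y - 2 * y * Real.cosh y) :=
    monotone_of_hasDerivAt_nonneg hd fun y => by have := Real.cosh_pos y; positivity
  have h := hm hx
  norm_num at h
  linarith

/-- The hyperbolic cardinal sine `sinh x / x`, extended by `1` at `0`. -/
noncomputable def sinhc (x : ℝ) : ℝ := if x = 0 then 1 else Real.sinh x / x

theorem sinhc_zero : sinhc 0 = 1 := if_pos rfl

theorem sinhc_of_ne_zero {x : ℝ} (hx : x ≠ 0) : sinhc x = Real.sinh x / x := if_neg hx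

theorem sinhc_eq_dslope : sinhc = dslope Real.sinh 0 := by
  ext x
  rcases eq_or_ne x 0 with rfl | hx
  · simp [sinhc]
  · simp [sinhc, hx, dslope_of_ne, slope_def_field]

theorem continuous_sinhc : Continuous sinhc := by
  rw [sinhc_eq_dslope, continuous_iff_continuousAt]
  intro x
  rcases eq_or_ne x 0 with rfl | hx
  · exact continuousAt_dslope_same.2 Real.differentiableAt_sinh
  · exact (continuousAt_dslope_of_ne hx).2 Real.continuous_sinh.continuousAt

theorem one_le_sinhc {x : ℝ} (hx : 0 ≤ x) : 1 ≤ sinhc x := by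
  rcases hx.eq_or_lt with rfl | hx
  · exact sinhc_zero.ge
  · rw [sinhc_of_ne_zero hx.ne', one_le_div hx]
    exact Real.self_le_sinh_iff.2 hx.le

theorem hasDerivAt_sinh_div {x : ℝ} (hx : x ≠ 0) :
    HasDerivAt (fun x => Real.sinh x / x) (Real.cosh x / x - Real.sinh x / x ^ 2) x := by
  refine HasDerivAt.congr_deriv ((Real.hasDerivAt_sinh x).div (hasDerivAt_id' x) hx) ?_
  field_simp

theorem hasDerivAt_cosh_div_sub {x : ℝ} (hx : x ≠ 0) :
    HasDerivAt (fun x => Real.cosh x / x - Real.sinh x / x ^ 2)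
      ((x ^ 2 * Real.sinh x + 2 * Real.sinh x - 2 * x * Real.cosh x) / x ^ 3) x := by
  refine HasDerivAt.congr_deriv (((Real.hasDerivAt_cosh x).div (hasDerivAt_id' x) hx).sub
    ((Real.hasDerivAt_sinh x).div (hasDerivAt_pow 2 x) (pow_ne_zero 2 hx))) ?_
  simp
  field_simp
  ring

theorem convexMonoNonneg_sinhc (b : ℝ) : ConvexMonoNonneg b sinhc :=
  .of_hasDerivAt continuous_sinhc.continuousOn
    (fun x hx => sinhc_of_ne_zero hx.1.ne')
    (fun x hx => hasDerivAt_sinh_div hx.1.ne')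
    (fun x hx => hasDerivAt_cosh_div_sub hx.1.ne')
    (fun x hx => div_nonneg (sub_nonneg.2 (Real.two_mul_mul_cosh_le hx.1.le))
      (pow_nonneg hx.1.le 3))
    (by rw [sinhc_zero]; exact zero_le_one)
    (fun x hx => by rw [sinhc_zero]; exact one_le_sinhc hx.1)

theorem phiMinus_zero : phiMinus 0 = 0 := if_pos rfl

theorem phiMinus_eq (x : ℝ) : phiMinus x = Real.cosh x - sinhc x := by
  rcases eq_or_ne x 0 with rfl | hx
  · simp [phiMinus, sinhc]
  · simp [phiMinus, sinhc, hx]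

theorem phiMinus_pos {x : ℝ} (hx : 0 < x) : 0 < phiMinus x := by
  rw [phiMinus, if_neg hx.ne', sub_pos, div_lt_iff₀ hx, mul_comm]
  exact Real.sinh_lt_mul_cosh hx

theorem convexMonoNonneg_phiMinus (b : ℝ) : ConvexMonoNonneg b phiMinus := by
  refine .of_hasDerivAt
    (g := fun x => Real.cosh x - Real.sinh x / x)
    (f' := fun x => Real.sinh x - (Real.cosh x / x - Real.sinh x / x ^ 2))
    (f'' := fun x => Real.cosh x -
      (x ^ 2 * Real.sinh x + 2 * Real.sinh x - 2 * x * Real.cosh x) / x ^ 3) ?_ ?_ ?_ ?_ ?_ ?_ ?_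
  · rw [funext phiMinus_eq]
    exact (Real.continuous_cosh.sub continuous_sinhc).continuousOn
  · exact fun x hx => if_neg hx.1.ne'
  · exact fun x hx => (Real.hasDerivAt_cosh x).sub (hasDerivAt_sinh_div hx.1.ne')
  · exact fun x hx => (Real.hasDerivAt_sinh x).sub (hasDerivAt_cosh_div_sub hx.1.ne')
  · intro x hx
    rw [sub_nonneg, div_le_iff₀ (pow_pos hx.1 3)]
    nlinarith [mul_pos (pow_pos hx.1 2) (sub_pos.2 (Real.sinh_lt_mul_cosh hx.1)),
      Real.sinh_lt_mul_cosh hx.1]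
  · exact phiMinus_zero.ge
  · intro x hx
    rw [phiMinus_zero]
    rcases hx.1.eq_or_lt with rfl | h
    · exact phiMinus_zero.ge
    · exact (phiMinus_pos h).le

theorem sinc_pos_of_lt_pi {x : ℝ} (hx : 0 ≤ x) (hxπ : x < π) : 0 < Real.sinc x := by
  rcases hx.eq_or_lt with rfl | h
  · simp
  · rw [Real.sinc_of_ne_zero h.ne']
    exact div_pos (Real.sin_pos_of_pos_of_lt_pi h hxπ) h

theorem convexMonoNonneg_one_sub_cos_div_sinc {b : ℝ} (hb : b < π) :
    ConvexMonoNonneg b fun x => 1 - Real.cos x / Real.sinc x := by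
  have hsin : ∀ x ∈ Set.Ioo 0 b, 0 < Real.sin x := fun x hx =>
    Real.sin_pos_of_pos_of_lt_pi hx.1 (hx.2.trans hb)
  refine .of_hasDerivAt
    (g := fun x => 1 - x * Real.cos x / Real.sin x)
    (f' := fun x => x / Real.sin x ^ 2 - Real.cos x / Real.sin x)
    (f'' := fun x => 2 * (Real.sin x - x * Real.cos x) / Real.sin x ^ 3) ?_ ?_ ?_ ?_ ?_ ?_ ?_
  · exact continuousOn_const.sub (Real.continuous_cos.continuousOn.div
      Real.continuous_sinc.continuousOn fun x hx => (sinc_pos_of_lt_pi hx.1 (hx.2.trans_lt hb)).ne')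
  · intro x hx
    have := hx.1.ne'
    have := (hsin x hx).ne'
    simp only [Real.sinc_of_ne_zero hx.1.ne']
    field_simp
  · intro x hx
    have hs := (hsin x hx).ne'
    refine HasDerivAt.congr_deriv ((((hasDerivAt_id' x).mul (Real.hasDerivAt_cos x)).div
      (Real.hasDerivAt_sin x) hs).const_sub 1) ?_
    field_simp
    simp only [Pi.mul_apply]
    linear_combination x * Real.sin_sq_add_cos_sq x
  · intro x hx
    have hs := (hsin x hx).ne'
    refine HasDerivAt.congr_deriv (((hasDerivAt_id' x).div ((Real.hasDerivAt_sin x).pow 2) (pow_ne_zero 2 hs)).sub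
      ((Real.hasDerivAt_cos x).div (Real.hasDerivAt_sin x) hs)) ?_
    simp
    field_simp
    linear_combination Real.sin x * Real.sin_sq_add_cos_sq x
  · intro x hx
    have := Real.mul_cos_lt_sin hx.1 (hx.2.trans hb).le
    exact div_nonneg (by linarith) (pow_nonneg (hsin x hx).le 3)
  · simp
  · intro x hx
    simp only [Real.cos_zero, Real.sinc_zero, div_one, sub_self, sub_nonneg]
    rw [div_le_one (sinc_pos_of_lt_pi hx.1 (hx.2.trans_lt hb))]
    rcases hx.1.eq_or_lt with rfl | h
    · simp
    · rw [Real.sinc_of_ne_zero h.ne', le_div_iff₀ h, mul_comm]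
      exact (Real.mul_cos_lt_sin h (hx.2.trans hb.le)).le

theorem convexMonoNonneg_cosh_div_sinhc_sub_one (b : ℝ) :
    ConvexMonoNonneg b fun x => Real.cosh x / sinhc x - 1 := by
  refine .of_hasDerivAt
    (g := fun x => x * Real.cosh x / Real.sinh x - 1)
    (f' := fun x => Real.cosh x / Real.sinh x - x / Real.sinh x ^ 2)
    (f'' := fun x => 2 * (x * Real.cosh x - Real.sinh x) / Real.sinh x ^ 3) ?_ ?_ ?_ ?_ ?_ ?_ ?_
  · exact (Real.continuous_cosh.continuousOn.div continuous_sinhc.continuousOn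
      fun x hx => (zero_lt_one.trans_le (one_le_sinhc hx.1)).ne').sub continuousOn_const
  · intro x hx
    have := hx.1.ne'
    have := (Real.sinh_pos_iff.2 hx.1).ne'
    simp only [sinhc_of_ne_zero hx.1.ne']
    field_simp
  · intro x hx
    have hs := (Real.sinh_pos_iff.2 hx.1).ne'
    refine HasDerivAt.congr_deriv ((((hasDerivAt_id' x).mul (Real.hasDerivAt_cosh x)).div
      (Real.hasDerivAt_sinh x) hs).sub_const 1) ?_
    field_simp
    simp only [Pi.mul_apply]
    linear_combination -x * Real.cosh_sq_sub_sinh_sq x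
  · intro x hx
    have hs := (Real.sinh_pos_iff.2 hx.1).ne'
    refine HasDerivAt.congr_deriv (((Real.hasDerivAt_cosh x).div (Real.hasDerivAt_sinh x) hs).sub
      ((hasDerivAt_id' x).div ((Real.hasDerivAt_sinh x).pow 2) (pow_ne_zero 2 hs))) ?_
    simp
    field_simp
    linear_combination -Real.sinh x * Real.cosh_sq_sub_sinh_sq x
  · intro x hx
    have := Real.sinh_lt_mul_cosh hx.1
    exact div_nonneg (by linarith) (pow_nonneg (Real.sinh_pos_iff.2 hx.1).le 3)
  · simp [sinhc_zero]
  · intro x hx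
    simp only [Real.cosh_zero, sinhc_zero, div_one, sub_self, sub_nonneg]
    rw [one_le_div (zero_lt_one.trans_le (one_le_sinhc hx.1))]
    rcases hx.1.eq_or_lt with rfl | h
    · simp [sinhc_zero]
    · rw [sinhc_of_ne_zero h.ne', div_le_iff₀ h, mul_comm]
      exact (Real.sinh_lt_mul_cosh h).le

theorem psiFun_of_pos {lam : ℝ} (hlam : 0 < lam) (r : ℝ) :
    psiFun lam r = 1 - Real.cos (√lam * r) / Real.sinc (√lam * r) := by
  rcases eq_or_ne r 0 with rfl | hr
  · simp [psiFun, hFun]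
  · have hx : √lam * r ≠ 0 := mul_ne_zero (Real.sqrt_pos.2 hlam).ne' hr
    rw [psiFun, hFun, if_neg (by simp [hlam.ne', hr]), if_pos hlam, Real.sign_of_pos hlam,
      Real.sinc_of_ne_zero hx, div_div_eq_mul_div]
    ring

theorem psiFun_of_neg {lam : ℝ} (hlam : lam < 0) (r : ℝ) :
    psiFun lam r = Real.cosh (√(-lam) * r) / sinhc (√(-lam) * r) - 1 := by
  rcases eq_or_ne r 0 with rfl | hr
  · simp [psiFun, hFun, sinhc_zero]
  · have hx : √(-lam) * r ≠ 0 := mul_ne_zero (Real.sqrt_pos.2 (neg_pos.2 hlam)).ne' hr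
    rw [psiFun, hFun, if_neg (by simp [hlam.ne, hr]), if_neg hlam.not_gt, Real.sign_of_neg hlam,
      sinhc_of_ne_zero hx, div_div_eq_mul_div]
    ring

theorem convexMonoNonneg_psiFun {lam b : ℝ} (hb : b * √(max 0 lam) < π) :
    ConvexMonoNonneg b (psiFun lam) := by
  rcases lt_trichotomy lam 0 with h | rfl | h
  · rw [funext (psiFun_of_neg h)]
    exact (convexMonoNonneg_cosh_div_sinhc_sub_one _).comp_mul_left (Real.sqrt_nonneg _)
  · have : psiFun 0 = fun _ => 0 := by ext r; simp [psiFun]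
    rw [this]
    exact .const le_rfl
  · rw [funext (psiFun_of_pos h)]
    rw [max_eq_right h.le, mul_comm] at hb
    exact (convexMonoNonneg_one_sub_cos_div_sinc hb).comp_mul_left (Real.sqrt_nonneg _)

theorem convexMonoNonneg_C1 (lam b : ℝ) : ConvexMonoNonneg b (C1 lam) := by
  rcases le_or_gt 0 lam with h | h
  · have : C1 lam = fun _ => 1 := by ext r; simp [C1, h]
    rw [this]
    exact .const zero_le_one
  · have : C1 lam = fun r => sinhc (√(-lam) * r) := by
      ext r
      simp [C1, sinhc, h.not_ge, (Real.sqrt_pos.2 (neg_pos.2 h)).ne']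
    rw [this]
    exact (convexMonoNonneg_sinhc _).comp_mul_left (Real.sqrt_nonneg _)

theorem kappaT_zero_zero (ρ D : ℝ) : kappaT 0 0 ρ D = 0 := by
  simp [kappaT, phiMinus, psiMax, psiFun]

theorem kappaT_eq_kappaT_zero_right (δ Δ ρ D : ℝ) : kappaT δ Δ ρ D = kappaT δ Δ (ρ + D) 0 := by
  simp [kappaT]

theorem convexMonoNonneg_C1_mul_psiMax {δ Δ b : ℝ} (hδΔ : δ ≤ Δ) (hb0 : 0 ≤ b)
    (hb : b * √(max 0 Δ) < π) : ConvexMonoNonneg b (C1 δ * psiMax δ Δ) := by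
  have hδ : b * √(max 0 δ) < π := lt_of_le_of_lt (by gcongr) hb
  exact (convexMonoNonneg_C1 δ b).mul
    ((convexMonoNonneg_psiFun hb).sup (convexMonoNonneg_psiFun hδ))

theorem convexMonoNonneg_phiMinus_mul (K b : ℝ) :
    ConvexMonoNonneg b fun r => phiMinus (√K * r) :=
  (convexMonoNonneg_phiMinus _).comp_mul_left (Real.sqrt_nonneg K)

theorem strictMonoOn_phiMinus_mul {K : ℝ} (hK : 0 < K) (b : ℝ) :
    StrictMonoOn (fun r => phiMinus (√K * r)) (Set.Icc 0 b) := by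
  refine (convexMonoNonneg_phiMinus_mul K b).strictMonoOn ?_ fun x hx => ?_
  · simp [phiMinus_zero]
  · exact phiMinus_pos (mul_pos (Real.sqrt_pos.2 hK) hx.1)

theorem kappaT_zero_right_eq_add (δ Δ : ℝ) :
    (fun r => kappaT δ Δ r 0) =
      (fun r => phiMinus (√(max |δ| |Δ|) * r)) + C1 δ * psiMax δ Δ := by
  ext r
  simp [kappaT, mul_comm r]

theorem convexMonoNonneg_kappaT {δ Δ b : ℝ} (hδΔ : δ ≤ Δ) (hb0 : 0 ≤ b)
    (hb : b * √(max 0 Δ) < π) : ConvexMonoNonneg b fun r => kappaT δ Δ r 0 := by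
  rw [kappaT_zero_right_eq_add]
  exact (convexMonoNonneg_phiMinus_mul _ b).add (convexMonoNonneg_C1_mul_psiMax hδΔ hb0 hb)

theorem strictMonoOn_kappaT {δ Δ b : ℝ} (hδΔ : δ ≤ Δ) (hb0 : 0 ≤ b)
    (hb : b * √(max 0 Δ) < π) (hK : 0 < max |δ| |Δ|) :
    StrictMonoOn (fun r => kappaT δ Δ r 0) (Set.Icc 0 b) := by
  rw [kappaT_zero_right_eq_add]
  exact (strictMonoOn_phiMinus_mul hK b).add_monotone
    (convexMonoNonneg_C1_mul_psiMax hδΔ hb0 hb).monotoneOn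

/-- If `k` is convex and strictly increasing on a set of nonnegative reals, then `(1 - k x) * x`
is strictly concave there. -/
theorem ConvexOn.strictConcaveOn_one_sub_mul {s : Set ℝ} {k : ℝ → ℝ} (hk : ConvexOn ℝ s k)
    (hmono : StrictMonoOn k s) (hs : ∀ x ∈ s, 0 ≤ x) :
    StrictConcaveOn ℝ s fun x => (1 - k x) * x := by
  refine ⟨hk.1, fun x hx y hy hxy a b ha hb hab => ?_⟩
  have hm := hk.2 hx hy ha.le hb.le hab
  have hm0 := hs _ (hk.1 hx hy ha.le hb.le hab)
  have hprod : 0 < (k y - k x) * (y - x) := by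
    rcases hxy.lt_or_gt with h | h
    · exact mul_pos (sub_pos.2 (hmono hx hy h)) (sub_pos.2 h)
    · exact mul_pos_of_neg_of_neg (sub_neg.2 (hmono hy hx h)) (sub_neg.2 h)
  simp only [smul_eq_mul] at hm hm0 ⊢
  have h1 := mul_le_mul_of_nonneg_right hm hm0
  have h2 := mul_pos (mul_pos ha hb) hprod
  obtain rfl : b = 1 - a := by linarith
  nlinarith

/-- Conclusion 6 of Lemma 4.5 of the paper (constant curvature bounds): for each
`D ∈ [0,r₁]`, the function `ρ ↦ s̃(ρ,D)` is concave on `[D,r₁]` and attains its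
maximum over `[D,r₁]` at a unique point. -/
theorem stmt16 (δ Δ r₁ : ℝ) (hδΔ : δ ≤ Δ) (hr₁ : 0 < r₁)
    (hreg : 2 * r₁ * Real.sqrt (max 0 Δ) < π)
    (D : ℝ) (hD : D ∈ Set.Icc 0 r₁) :
    ConcaveOn ℝ (Set.Icc D r₁) (fun ρ => sT δ Δ ρ D) ∧
    ∃! ρ₂ : ℝ, ρ₂ ∈ Set.Icc D r₁ ∧
      IsMaxOn (fun ρ => sT δ Δ ρ D) (Set.Icc D r₁) ρ₂ := by
  obtain ⟨hD0, hDr⟩ := hD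
  rcases (le_max_of_le_left (abs_nonneg δ) : 0 ≤ max |δ| |Δ|).eq_or_lt with hK | hK
  · obtain rfl : δ = 0 := abs_nonpos_iff.1 (hK ▸ le_max_left _ _)
    obtain rfl : Δ = 0 := abs_nonpos_iff.1 (hK ▸ le_max_right _ _)
    have hs : (fun ρ => sT 0 0 ρ D) = fun ρ => ρ := by
      ext ρ
      simp [sT, kappaT_zero_zero]
    rw [hs]
    refine ⟨concaveOn_id (convex_Icc D r₁), r₁, ⟨⟨hDr, le_rfl⟩, fun x hx => hx.2⟩, ?_⟩
    exact fun y hy => le_antisymm hy.1.2 (hy.2 ⟨hDr, le_rfl⟩)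
  have hb : 0 ≤ 2 * r₁ := by positivity
  have hκ := convexMonoNonneg_kappaT hδΔ hb hreg
  have hmaps : ∀ x ∈ Set.Icc D r₁, x + D ∈ Set.Icc 0 (2 * r₁) := fun x hx =>
    ⟨by linarith [hx.1], by linarith [hx.2]⟩
  have hcont : ContinuousOn (fun ρ => kappaT δ Δ (ρ + D) 0) (Set.Icc D r₁) :=
    hκ.continuousOn.comp (by fun_prop) hmaps
  have hconv : ConvexOn ℝ (Set.Icc D r₁) fun ρ => kappaT δ Δ (ρ + D) 0 :=
    (hκ.convexOn.translate_left D).subset (fun x hx => by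
      simpa only [Set.mem_preimage, add_comm D x] using hmaps x hx) (convex_Icc D r₁)
  have hmono : StrictMonoOn (fun ρ => kappaT δ Δ (ρ + D) 0) (Set.Icc D r₁) :=
    fun x hx y hy hxy => strictMonoOn_kappaT hδΔ hb hreg hK (hmaps x hx) (hmaps y hy)
      (by linarith)
  have hs : (fun ρ => sT δ Δ ρ D) = fun ρ => (1 - kappaT δ Δ (ρ + D) 0) * ρ := by
    ext ρ
    rw [sT, kappaT_eq_kappaT_zero_right]
  rw [hs]
  have hconc := hconv.strictConcaveOn_one_sub_mul hmono fun x hx => hD0.trans hx.1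
  refine ⟨hconc.concaveOn, ?_⟩
  obtain ⟨m, hm, hmax⟩ := isCompact_Icc.exists_isMaxOn (Set.nonempty_Icc.2 hDr)
    ((continuousOn_const.sub hcont).mul continuousOn_id)
  exact ⟨m, ⟨hm, hmax⟩, fun y hy => hconc.eq_of_isMaxOn hy.2 hmax hy.1 hm⟩
end

section
/- Fix real numbers δ ≤ Δ and r₁ > 0 with 2·r₁·√(max(0,Δ)) < π, and define s̃ as in the context. Then there exist D ∈ (0, r₁] and ρ ∈ [D, r₁] such that s̃(ρ, D) > D. (In the paper's notation, the critical diameter D̃_crit = sup{D ∈ [0,r₁] : ∃ ρ ∈ [D,r₁] with s̃(ρ,D) > D} is strictly positive.) -/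
open scoped Real

open Filter Topology

theorem tendsto_sinh_div_self :
    Tendsto (fun x : ℝ => Real.sinh x / x) (𝓝[≠] 0) (𝓝 1) := by
  have h := (Real.hasDerivAt_sinh 0).tendsto_slope_zero
  simpa [div_eq_inv_mul] using h

theorem tendsto_sin_div_self :
    Tendsto (fun x : ℝ => Real.sin x / x) (𝓝[≠] 0) (𝓝 1) := by
  have h := (Real.hasDerivAt_sin 0).tendsto_slope_zero
  simpa [div_eq_inv_mul] using h

theorem tendsto_mul_cos_div_sin :
    Tendsto (fun x : ℝ => x * (Real.cos x / Real.sin x)) (𝓝[≠] 0) (𝓝 1) := by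
  have hc : Tendsto Real.cos (𝓝[≠] 0) (𝓝 1) := by
    simpa using (Real.continuous_cos.tendsto 0).mono_left nhdsWithin_le_nhds
  have h := hc.mul (tendsto_sin_div_self.inv₀ one_ne_zero)
  rw [inv_one, mul_one] at h
  refine h.congr fun x => ?_
  rw [inv_div]
  ring

theorem tendsto_mul_cosh_div_sinh :
    Tendsto (fun x : ℝ => x * (Real.cosh x / Real.sinh x)) (𝓝[≠] 0) (𝓝 1) := by
  have hc : Tendsto Real.cosh (𝓝[≠] 0) (𝓝 1) := by
    simpa using (Real.continuous_cosh.tendsto 0).mono_left nhdsWithin_le_nhds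
  have h := hc.mul (tendsto_sinh_div_self.inv₀ one_ne_zero)
  rw [inv_one, mul_one] at h
  refine h.congr fun x => ?_
  rw [inv_div]
  ring

theorem tendsto_const_mul_nhdsGT_zero {c : ℝ} (hc : c ≠ 0) :
    Tendsto (fun r : ℝ => c * r) (𝓝[>] 0) (𝓝[≠] 0) := by
  refine tendsto_nhdsWithin_iff.2 ⟨?_, ?_⟩
  · have h : Tendsto (fun r : ℝ => c * r) (𝓝 0) (𝓝 (c * 0)) :=
      (continuous_const_mul c).tendsto 0
    rw [mul_zero] at h
    exact h.mono_left nhdsWithin_le_nhds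
  · filter_upwards [self_mem_nhdsWithin] with r hr
    exact mul_ne_zero hc (ne_of_gt hr)

theorem tendsto_phiMinus_nhdsNE_zero : Tendsto phiMinus (𝓝[≠] 0) (𝓝 0) := by
  have hc : Tendsto Real.cosh (𝓝[≠] 0) (𝓝 1) := by
    simpa using (Real.continuous_cosh.tendsto 0).mono_left nhdsWithin_le_nhds
  have h := hc.sub tendsto_sinh_div_self
  rw [sub_self] at h
  refine h.congr' ?_
  filter_upwards [self_mem_nhdsWithin] with x hx
  exact (if_neg hx).symm

theorem tendsto_phiMinus_mul_const (c : ℝ) :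
    Tendsto (fun r => phiMinus (r * c)) (𝓝[>] 0) (𝓝 0) := by
  rcases eq_or_ne c 0 with rfl | hc
  · simp [phiMinus]
  · simpa only [Function.comp_def, mul_comm c] using
      tendsto_phiMinus_nhdsNE_zero.comp (tendsto_const_mul_nhdsGT_zero hc)

theorem tendsto_C1_nhdsGT_zero (lam : ℝ) : Tendsto (C1 lam) (𝓝[>] 0) (𝓝 1) := by
  rcases le_or_gt 0 lam with h | h
  · exact tendsto_const_nhds.congr fun r => (if_pos (Or.inl h)).symm
  · have hs : Real.sqrt (-lam) ≠ 0 := (Real.sqrt_pos.2 (neg_pos.2 h)).ne'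
    refine (tendsto_sinh_div_self.comp (tendsto_const_mul_nhdsGT_zero hs)).congr' ?_
    filter_upwards [self_mem_nhdsWithin] with r hr
    exact (if_neg (not_or.2 ⟨h.not_ge, ne_of_gt hr⟩)).symm

theorem tendsto_hFun_nhdsGT_zero (lam : ℝ) : Tendsto (hFun lam) (𝓝[>] 0) (𝓝 1) := by
  rcases lt_trichotomy lam 0 with h | h | h
  · have hs : Real.sqrt (-lam) ≠ 0 := (Real.sqrt_pos.2 (neg_pos.2 h)).ne'
    refine (tendsto_mul_cosh_div_sinh.comp (tendsto_const_mul_nhdsGT_zero hs)).congr' ?_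
    filter_upwards [self_mem_nhdsWithin] with r hr
    rw [hFun, if_neg (not_or.2 ⟨h.ne, ne_of_gt hr⟩), if_neg h.not_gt, Function.comp_apply]
  · exact tendsto_const_nhds.congr fun r => (if_pos (Or.inl h)).symm
  · have hs : Real.sqrt lam ≠ 0 := (Real.sqrt_pos.2 h).ne'
    refine (tendsto_mul_cos_div_sin.comp (tendsto_const_mul_nhdsGT_zero hs)).congr' ?_
    filter_upwards [self_mem_nhdsWithin] with r hr
    rw [hFun, if_neg (not_or.2 ⟨h.ne', ne_of_gt hr⟩), if_pos h, Function.comp_apply]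

theorem tendsto_psiFun_nhdsGT_zero (lam : ℝ) : Tendsto (psiFun lam) (𝓝[>] 0) (𝓝 0) := by
  have h := ((tendsto_hFun_nhdsGT_zero lam).const_sub 1).const_mul (Real.sign lam)
  rw [sub_self, mul_zero] at h
  exact h

theorem tendsto_psiMax_nhdsGT_zero (δ Δ : ℝ) : Tendsto (psiMax δ Δ) (𝓝[>] 0) (𝓝 0) := by
  have h := (tendsto_psiFun_nhdsGT_zero Δ).max (tendsto_psiFun_nhdsGT_zero δ)
  rw [max_self] at h
  exact h

theorem tendsto_kappaT_nhdsGT_zero (δ Δ : ℝ) :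
    Tendsto (fun r => kappaT δ Δ r 0) (𝓝[>] 0) (𝓝 0) := by
  have h := (tendsto_phiMinus_mul_const (Real.sqrt (max |δ| |Δ|))).add
    ((tendsto_C1_nhdsGT_zero δ).mul (tendsto_psiMax_nhdsGT_zero δ Δ))
  simpa only [kappaT, add_zero, mul_zero] using h

/-- The assertion `D̃_crit > 0` from Lemma 4.5 of the paper: there exist `D ∈ (0,r₁]`
and `ρ ∈ [D,r₁]` with `s̃(ρ,D) > D`. -/
theorem stmt18 (δ Δ r₁ : ℝ) (hδΔ : δ ≤ Δ) (hr₁ : 0 < r₁)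
    (hreg : 2 * r₁ * Real.sqrt (max 0 Δ) < π) :
    ∃ D : ℝ, D ∈ Set.Ioc 0 r₁ ∧ ∃ ρ : ℝ, ρ ∈ Set.Icc D r₁ ∧ D < sT δ Δ ρ D := by
  have hκ : ∀ᶠ r in 𝓝[>] (0 : ℝ), kappaT δ Δ r 0 < 1 / 2 :=
    (tendsto_kappaT_nhdsGT_zero δ Δ).eventually_lt_const (by norm_num)
  have hr : ∀ᶠ r in 𝓝[>] (0 : ℝ), r ∈ Set.Ioc 0 r₁ := Ioc_mem_nhdsGT hr₁
  obtain ⟨r, hκr, hr0, hr1⟩ := (hκ.and hr).exists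
  refine ⟨r / 3, ⟨by linarith, by linarith⟩, 2 * r / 3, ⟨by linarith, by linarith⟩, ?_⟩
  have hsum : kappaT δ Δ (2 * r / 3) (r / 3) = kappaT δ Δ r 0 := by
    have : 2 * r / 3 + r / 3 = r + 0 := by ring
    simp only [kappaT, this]
  rw [sT, hsum]
  nlinarith
end
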